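/- Let Γ ⊂ ℤ^n be an almost periodic pattern with D(Γ) > 0 and let P ∈ O_n(ℝ) be such that for every v ∈ ℤ^n the set P(Γ ∩ (Γ − v)) is equidistributed modulo ℤ^n. If D(P̂(Γ)) = D(Γ), then for every u ∈ ℤ^n, ρ_{P̂(Γ)}(u) = Σ_{v∈ℤ^n} φ_{P v}(u) · ρ_Γ(v). -/

import Mathlib

open Filter MeasureTheory
open scoped BigOperators

noncomputable section

/-- The projection `p : ℝ → ℤ`: the unique `k` with `k - 1/2 < x ≤ k + 1/2`. -/
def roundHalf (x : ℝ) : ℤ := ⌈x - 1/2⌉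

/-- Coercion of an integer vector to a real vector. -/
def intVec {n : ℕ} (v : Fin n → ℤ) : Fin n → ℝ := fun i => (v i : ℝ)

/-- The set of integer points of `ℝ^n`. -/
def intPoints (n : ℕ) : Set (Fin n → ℝ) := Set.range (intVec (n := n))

/-- The coordinatewise projection `π : ℝ^n → ℤ^n`. -/
def discretize {n : ℕ} (x : Fin n → ℝ) : Fin n → ℤ := fun i => roundHalf (x i)

/-- `π` viewed as a self-map of `ℝ^n`. -/
def discretizeR {n : ℕ} (x : Fin n → ℝ) : Fin n → ℝ := intVec (discretize x)

/-- The image of a set `Γ` under the discretization `P̂` of the matrix `P`. -/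
def PhatImg {n : ℕ} (P : Matrix (Fin n) (Fin n) ℝ) (Γ : Set (Fin n → ℝ)) :
    Set (Fin n → ℝ) :=
  (fun x => discretizeR (P.mulVec x)) '' Γ

/-- The uniform `R`-density `D_R^+`. Balls are sup-norm balls. -/
def DRplus {n : ℕ} (Γ : Set (Fin n → ℝ)) (R : ℝ) : ℝ :=
  ⨆ x : Fin n → ℝ,
    ((Metric.ball x R ∩ Γ).ncard : ℝ) / ((Metric.ball x R ∩ intPoints n).ncard : ℝ)

/-- Relatively dense with parameter `R₀`. -/
def RelativelyDenseWith {n : ℕ} (Γ : Set (Fin n → ℝ)) (R₀ : ℝ) : Prop :=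
  ∀ x : Fin n → ℝ, ∀ r, R₀ ≤ r → (Metric.ball x r ∩ Γ).Nonempty

def RelativelyDense {n : ℕ} (Γ : Set (Fin n → ℝ)) : Prop :=
  ∃ R₀ > 0, RelativelyDenseWith Γ R₀

/-- Uniformly discrete with parameter `r₀`. -/
def UniformlyDiscreteWith {n : ℕ} (Γ : Set (Fin n → ℝ)) (r₀ : ℝ) : Prop :=
  ∀ x : Fin n → ℝ, ∀ r, 0 < r → r ≤ r₀ → (Metric.ball x r ∩ Γ).Subsingleton

def UniformlyDiscrete {n : ℕ} (Γ : Set (Fin n → ℝ)) : Prop :=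
  ∃ r₀ > 0, UniformlyDiscreteWith Γ r₀

def Delone {n : ℕ} (Γ : Set (Fin n → ℝ)) : Prop :=
  RelativelyDense Γ ∧ UniformlyDiscrete Γ

/-- The translateSet `Γ + v`. -/
def translateSet {n : ℕ} (Γ : Set (Fin n → ℝ)) (v : Fin n → ℝ) : Set (Fin n → ℝ) :=
  (· + v) '' Γ

/-- `N` is a set of `ε`-translations of `Γ` with radius `Rε`. -/
def IsEpsTranslationSet {n : ℕ} (Γ : Set (Fin n → ℝ)) (ε Rε : ℝ)
    (N : Set (Fin n → ℝ)) : Prop :=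
  N ⊆ intPoints n ∧ RelativelyDense N ∧
    ∀ R, Rε ≤ R → ∀ v ∈ N, DRplus (symmDiff (translateSet Γ v) Γ) R < ε

/-- Almost periodic pattern. -/
def AlmostPeriodicPattern {n : ℕ} (Γ : Set (Fin n → ℝ)) : Prop :=
  Γ ⊆ intPoints n ∧ Delone Γ ∧
    ∀ ε > 0, ∃ Rε > 0, ∃ N : Set (Fin n → ℝ), IsEpsTranslationSet Γ ε Rε N

/-- `Γ` has uniform density `D`. -/
def HasUnifDensity {n : ℕ} (Γ : Set (Fin n → ℝ)) (D : ℝ) : Prop :=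
  ∀ ε > 0, ∃ R₀ > 0, ∀ R, R₀ ≤ R → ∀ x : Fin n → ℝ,
    |((Metric.ball x R ∩ Γ).ncard : ℝ) / ((Metric.ball x R ∩ intPoints n).ncard : ℝ) - D| ≤ ε

/-- `Γ ∩ (Γ - v)`, the set of `x ∈ Γ` with `x + v ∈ Γ`. -/
def diffSet {n : ℕ} (Γ : Set (Fin n → ℝ)) (v : Fin n → ℝ) : Set (Fin n → ℝ) :=
  Γ ∩ {x | x + v ∈ Γ}

/-- `E` is equidistributed modulo `ℤ^n`: averages of continuous `ℤ^n`-periodic functions over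
`E ∩ B_R` converge to the Haar integral. -/
def EquidistributedModZn {n : ℕ} (E : Set (Fin n → ℝ)) : Prop :=
  ∀ f : (Fin n → ℝ) → ℝ, Continuous f →
    (∀ (x : Fin n → ℝ) (v : Fin n → ℤ), f (x + intVec v) = f x) →
    Filter.Tendsto (fun R : ℝ =>
        (∑ᶠ x ∈ E ∩ Metric.ball (0 : Fin n → ℝ) R, f x) /
          ((E ∩ Metric.ball (0 : Fin n → ℝ) R).ncard : ℝ))
      Filter.atTop
      (nhds (∫ x in Set.pi Set.univ (fun _ : Fin n => Set.Ico (0:ℝ) 1), f x))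

/-- `P` is totally irrational: `P(ℤ^n)` is equidistributed modulo `ℤ^n`. -/
def TotallyIrrational {n : ℕ} (P : Matrix (Fin n) (Fin n) ℝ) : Prop :=
  EquidistributedModZn (P.mulVec '' intPoints n)

/-- Rate of injectivity in time 1. -/
def tauOne {n : ℕ} (P : Matrix (Fin n) (Fin n) ℝ) : ℝ :=
  Filter.limsup (fun R : ℝ =>
    ((PhatImg P (intPoints n) ∩ Metric.ball (0 : Fin n → ℝ) R).ncard : ℝ) /
      ((intPoints n ∩ Metric.ball (0 : Fin n → ℝ) R).ncard : ℝ)) Filter.atTop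

/-- The successive images `(P̂_k ∘ ⋯ ∘ P̂_1)(Γ)`. -/
def seqImg {n : ℕ} (P : ℕ → Matrix (Fin n) (Fin n) ℝ) :
    ℕ → Set (Fin n → ℝ) → Set (Fin n → ℝ)
  | 0, Γ => Γ
  | k + 1, Γ => PhatImg (P (k + 1)) (seqImg P k Γ)

/-- Rate of injectivity in time `k` of the sequence `(P_k)`. -/
def tauK {n : ℕ} (P : ℕ → Matrix (Fin n) (Fin n) ℝ) (k : ℕ) : ℝ :=
  Filter.limsup (fun R : ℝ =>
    ((seqImg P k (intPoints n) ∩ Metric.ball (0 : Fin n → ℝ) R).ncard : ℝ) /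
      ((intPoints n ∩ Metric.ball (0 : Fin n → ℝ) R).ncard : ℝ)) Filter.atTop

/-- A fixed norm on `M_n(ℝ)`: the sup of absolute values of the entries. -/
def matNorm {n : ℕ} (A : Matrix (Fin n) (Fin n) ℝ) : ℝ :=
  ⨆ p : Fin n × Fin n, |A p.1 p.2|


/-- The function `φ_u`, a "weighted projection" of `u` on `ℤ^n`. -/
def phiFn {n : ℕ} (u : Fin n → ℝ) (v : Fin n → ℤ) : ℝ :=
  if ‖u - intVec v‖ < 1 then ∏ i, (1 - |u i - (v i : ℝ)|) else 0

/-- `I_ℚ(A)`: the set of indices `i` such that all entries of the `i`-th row of `A`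
are rational. -/
def IQ {n : ℕ} (A : Matrix (Fin n) (Fin n) ℝ) : Set (Fin n) :=
  {i | ∀ j, ∃ q : ℚ, A i j = (q : ℝ)}

/-- A sequence of matrices all lying in `O_n(ℝ)`. -/
def IsOnSeq {n : ℕ} (P : ℕ → Matrix (Fin n) (Fin n) ℝ) : Prop :=
  ∀ k, P k ∈ Matrix.orthogonalGroup (Fin n) ℝ

/-- The `ℓ^∞` distance on sequences of matrices. -/
def seqDist {n : ℕ} (P Q : ℕ → Matrix (Fin n) (Fin n) ℝ) : ℝ :=
  ⨆ k : ℕ, matNorm (P k - Q k)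

/-- Open subsets of `ℓ^∞(O_n(ℝ))`. -/
def IsOpenSeq {n : ℕ} (U : Set {P : ℕ → Matrix (Fin n) (Fin n) ℝ // IsOnSeq P}) : Prop :=
  ∀ P ∈ U, ∃ δ > 0, ∀ Q : {P : ℕ → Matrix (Fin n) (Fin n) ℝ // IsOnSeq P},
    seqDist P.1 Q.1 < δ → Q ∈ U

/-- Dense subsets of `ℓ^∞(O_n(ℝ))`. -/
def IsDenseSeq {n : ℕ} (U : Set {P : ℕ → Matrix (Fin n) (Fin n) ℝ // IsOnSeq P}) : Prop :=
  ∀ P : {P : ℕ → Matrix (Fin n) (Fin n) ℝ // IsOnSeq P}, ∀ δ > 0,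
    ∃ Q ∈ U, seqDist P.1 Q.1 < δ

theorem ncard_inter_le_finsum {α : Type*} {S W : Set α} (hS : S.Finite) {f : α → ℝ}
    (hf : ∀ x, 0 ≤ f x) (hfW : ∀ x ∈ W, 1 ≤ f x) :
    ((S ∩ W).ncard : ℝ) ≤ ∑ᶠ x ∈ S, f x := by
  classical
  have hfin : (S ∩ W).Finite := hS.subset Set.inter_subset_left
  rw [finsum_mem_eq_finite_toFinset_sum _ hS, Set.ncard_eq_toFinset_card _ hfin]
  calc ((hfin.toFinset.card : ℕ) : ℝ) = ∑ x ∈ hfin.toFinset, (1 : ℝ) := by simp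
    _ ≤ ∑ x ∈ hfin.toFinset, f x := by
        refine Finset.sum_le_sum fun x hx => hfW x ?_
        simp at hx; exact hx.2
    _ ≤ ∑ x ∈ hS.toFinset, f x := by
        refine Finset.sum_le_sum_of_subset_of_nonneg ?_ fun x _ _ => hf x
        intro x; simp; tauto

/-- The half-open unit cube. -/
abbrev unitCube (n : ℕ) : Set (Fin n → ℝ) := Set.pi Set.univ fun _ => Set.Ico (0 : ℝ) 1

theorem volume_unitCube (n : ℕ) : volume (unitCube n) = 1 := by
  simp [unitCube, volume_pi_pi]

instance {n : ℕ} : IsFiniteMeasure (volume.restrict (unitCube n)) :=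
  ⟨by simp [volume_unitCube]⟩

theorem exists_continuous_periodic_approx {n : ℕ} {W : Set (Fin n → ℝ)}
    (hW : ∀ (x : Fin n → ℝ) (v : Fin n → ℤ), x + intVec v ∈ W ↔ x ∈ W) {c : ℝ}
    (hc : volume.real (closure W ∩ unitCube n) < c) :
    ∃ f : (Fin n → ℝ) → ℝ, Continuous f ∧
      (∀ (x : Fin n → ℝ) (v : Fin n → ℤ), f (x + intVec v) = f x) ∧
      (∀ x, 0 ≤ f x) ∧ (∀ x ∈ W, 1 ≤ f x) ∧ ∫ x in unitCube n, f x < c := by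
  have hpos : ∀ k : ℕ, (0 : ℝ) < 1 / ((k : ℝ) + 1) := fun k => by positivity
  have hlim := thickenedIndicator_tendsto_indicator_closure hpos
    tendsto_one_div_add_atTop_nhds_zero_nat W
  have hint : Tendsto (fun k : ℕ => ∫ x in unitCube n, (thickenedIndicator (hpos k) W x : ℝ))
      atTop (nhds (∫ x in unitCube n, (closure W).indicator (fun _ => (1 : ℝ)) x)) := by
    refine tendsto_integral_of_dominated_convergence (fun _ => 1) ?_ (integrable_const _) ?_ ?_
    · intro k
      exact (NNReal.continuous_coe.comp
        (thickenedIndicator (hpos k) W).continuous).aestronglyMeasurable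
    · intro k
      refine Eventually.of_forall fun x => ?_
      rw [Real.norm_eq_abs, NNReal.abs_eq]
      exact_mod_cast thickenedIndicator_le_one (hpos k) W x
    · refine Eventually.of_forall fun x => ?_
      have h1 := (NNReal.continuous_coe.tendsto _).comp ((tendsto_pi_nhds.1 hlim) x)
      have h2 : (closure W).indicator (fun _ => (1 : ℝ)) x =
          NNReal.toReal ((closure W).indicator (fun _ => (1 : NNReal)) x) := by
        by_cases hx : x ∈ closure W <;> simp [hx]
      rw [h2]
      exact h1
  rw [integral_indicator isClosed_closure.measurableSet] at hint
  simp only [integral_const, smul_eq_mul, mul_one, measureReal_restrict_apply_univ,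
    Measure.restrict_restrict isClosed_closure.measurableSet] at hint
  obtain ⟨k, hk⟩ := (hint.eventually_lt_const hc).exists
  refine ⟨fun x => (thickenedIndicator (hpos k) W x : ℝ), ?_, ?_, ?_, ?_, hk⟩
  · exact NNReal.continuous_coe.comp (thickenedIndicator (hpos k) W).continuous
  · intro x v
    have himg : W = (IsometryEquiv.addRight (intVec v)) '' W := by
      ext y
      simp only [IsometryEquiv.addRight_apply, Set.mem_image]
      constructor
      · intro hy
        refine ⟨y - intVec v, ?_, by simp⟩
        rw [← hW _ v]; simpa using hy
      · rintro ⟨z, hz, rfl⟩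
        exact (hW z v).2 hz
    have : Metric.infEDist (x + intVec v) W = Metric.infEDist x W := by
      conv_lhs => rw [himg]
      exact Metric.infEDist_image (IsometryEquiv.addRight (intVec v)).isometry
    simp only [thickenedIndicator_apply, thickenedIndicatorAux, this]
  · intro x; positivity
  · intro x hx
    exact_mod_cast one_le_thickenedIndicator_apply _ (hpos k) hx

theorem EquidistributedModZn.eventually_ncard_le {n : ℕ} {E W : Set (Fin n → ℝ)}
    (hE : EquidistributedModZn E) (hfin : ∀ R, (E ∩ Metric.ball 0 R).Finite)
    (hW : ∀ (x : Fin n → ℝ) (v : Fin n → ℤ), x + intVec v ∈ W ↔ x ∈ W) {c : ℝ}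
    (hc : volume.real (closure W ∩ unitCube n) < c) :
    ∀ᶠ R in atTop, ((E ∩ Metric.ball 0 R ∩ W).ncard : ℝ) ≤
      c * ((E ∩ Metric.ball 0 R).ncard : ℝ) := by
  obtain ⟨f, hf, hper, hf0, hf1, hlt⟩ := exists_continuous_periodic_approx hW hc
  filter_upwards [(hE f hf hper).eventually_lt_const hlt] with R hR
  rcases Nat.eq_zero_or_pos (E ∩ Metric.ball 0 R).ncard with h0 | h0
  · have := Set.ncard_le_ncard (Set.inter_subset_left (s := E ∩ Metric.ball 0 R) (t := W)) (hfin R)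
    have h2 : (E ∩ Metric.ball 0 R ∩ W).ncard = 0 := by omega
    simp [h0, h2]
  · rw [div_lt_iff₀ (by exact_mod_cast h0)] at hR
    exact (ncard_inter_le_finsum (hfin R) hf0 hf1).trans hR.le

theorem EquidistributedModZn.tendsto_ncard {n : ℕ} {E W : Set (Fin n → ℝ)}
    (hE : EquidistributedModZn E) (hfin : ∀ R, (E ∩ Metric.ball 0 R).Finite)
    (hW : ∀ (x : Fin n → ℝ) (v : Fin n → ℤ), x + intVec v ∈ W ↔ x ∈ W) {c d : ℝ}
    (hcl : volume.real (closure W ∩ unitCube n) = c)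
    (hint : volume.real (interior W ∩ unitCube n) = c) {g : ℝ → ℝ}
    (hg : Tendsto (fun R => ((E ∩ Metric.ball 0 R).ncard : ℝ) / g R) atTop (nhds d))
    (hg0 : ∀ᶠ R in atTop, 0 < g R) :
    Tendsto (fun R => ((E ∩ Metric.ball 0 R ∩ W).ncard : ℝ) / g R) atTop (nhds (c * d)) := by
  have hd : 0 ≤ d := ge_of_tendsto hg (hg0.mono fun R h => by positivity)
  have hcompl : volume.real (closure Wᶜ ∩ unitCube n) = 1 - c := by
    have h1 := measureReal_inter_add_sdiff (μ := volume) (s := unitCube n)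
      (isOpen_interior (s := W)).measurableSet (by simp [volume_unitCube])
    rw [closure_compl, Set.inter_comm, ← Set.sdiff_eq, ← hint]
    rw [Set.inter_comm] at h1
    have h3 : volume.real (unitCube n) = 1 := by simp [measureReal_def, volume_unitCube]
    linarith
  have key : ∀ ε > 0, ∀ᶠ R in atTop,
      |((E ∩ Metric.ball 0 R ∩ W).ncard : ℝ) / g R -
        c * (((E ∩ Metric.ball 0 R).ncard : ℝ) / g R)| ≤
        ε * (((E ∩ Metric.ball 0 R).ncard : ℝ) / g R) := by
    intro ε hε
    filter_upwards [hE.eventually_ncard_le hfin hW (c := c + ε) (by linarith),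
      hE.eventually_ncard_le (W := Wᶜ) hfin (fun x v => (hW x v).not) (c := 1 - c + ε)
        (by linarith), hg0] with R h1 h2 h3
    have h4 := Set.ncard_inter_add_ncard_sdiff_eq_ncard (E ∩ Metric.ball 0 R) W (hfin R)
    rw [Set.sdiff_eq] at h4
    have h5 : ((E ∩ Metric.ball 0 R ∩ W).ncard : ℝ) + ((E ∩ Metric.ball 0 R ∩ Wᶜ).ncard : ℝ) =
      ((E ∩ Metric.ball 0 R).ncard : ℝ) := by exact_mod_cast h4
    rw [← mul_div_assoc, ← sub_div, ← mul_div_assoc, abs_div, abs_of_pos h3]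
    gcongr
    rw [abs_le]; constructor <;> linarith
  have hdiff : Tendsto (fun R => ((E ∩ Metric.ball 0 R ∩ W).ncard : ℝ) / g R -
        c * (((E ∩ Metric.ball 0 R).ncard : ℝ) / g R)) atTop (nhds 0) := by
    rw [Metric.tendsto_nhds]
    intro ε hε
    filter_upwards [key (ε / (2 * (d + 1))) (by positivity),
      hg.eventually_lt_const (lt_add_one d)] with R h1 h2
    rw [dist_zero_right, Real.norm_eq_abs]
    calc _ ≤ _ := h1
      _ ≤ ε / (2 * (d + 1)) * (d + 1) := by gcongr
      _ = ε / 2 := by field_simp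
      _ < ε := by linarith
  simpa using hdiff.add (hg.const_mul c)

theorem roundHalf_eq_iff {x : ℝ} {k : ℤ} :
    roundHalf x = k ↔ (k : ℝ) - 1 / 2 < x ∧ x ≤ k + 1 / 2 := by
  rw [roundHalf, Int.ceil_eq_iff]
  constructor <;> rintro ⟨h1, h2⟩ <;> constructor <;> linarith

theorem roundHalf_add_int (x : ℝ) (k : ℤ) : roundHalf (x + k) = roundHalf x + k := by
  rw [roundHalf, roundHalf, ← Int.ceil_add_intCast]
  congr 1; ring

theorem measurable_roundHalf : Measurable roundHalf :=
  Int.measurable_ceil.comp (measurable_id.sub_const _)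

theorem eventually_roundHalf_eq {x : ℝ} (hx : ∀ k : ℤ, x ≠ k + 1 / 2) :
    ∀ᶠ y in nhds x, roundHalf y = roundHalf x := by
  obtain ⟨h1, h2⟩ := roundHalf_eq_iff.1 (rfl : roundHalf x = roundHalf x)
  filter_upwards [Ioo_mem_nhds h1 (lt_of_le_of_ne h2 (hx _))] with y hy
  exact roundHalf_eq_iff.2 ⟨hy.1, hy.2.le⟩

/-- The reals whose rounding moves by exactly `k` under translation by `w`. -/
def roundShift (w : ℝ) (k : ℤ) : Set ℝ := {t | roundHalf (t + w) = roundHalf t + k}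

theorem measurableSet_roundShift (w : ℝ) (k : ℤ) : MeasurableSet (roundShift w k) :=
  measurableSet_eq_fun (measurable_roundHalf.comp (measurable_id.add_const w))
    (measurable_roundHalf.add_const k)

theorem add_intCast_mem_roundShift (w : ℝ) (k : ℤ) (t : ℝ) (m : ℤ) :
    t + m ∈ roundShift w k ↔ t ∈ roundShift w k := by
  simp only [roundShift, Set.mem_ofPred_eq]
  rw [add_right_comm, roundHalf_add_int, roundHalf_add_int]
  constructor <;> intro h <;> linarith

theorem volume_frontier_roundShift (w : ℝ) (k : ℤ) : volume (frontier (roundShift w k)) = 0 := by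
  have hsub : frontier (roundShift w k) ⊆
      Set.range (fun m : ℤ => (m : ℝ) + 1 / 2) ∪ Set.range (fun m : ℤ => (m : ℝ) + 1 / 2 - w) := by
    intro t ht
    by_contra hcon
    simp only [Set.mem_union, Set.mem_range, not_or, not_exists] at hcon
    obtain ⟨h1, h2⟩ := hcon
    have e1 := eventually_roundHalf_eq (x := t) fun m h => h1 m h.symm
    have e2 := eventually_roundHalf_eq (x := t + w) fun m h => h2 m (by linarith)
    have e3 := ((by fun_prop : Continuous fun s : ℝ => s + w).tendsto t).eventually e2
    have e4 : ∀ᶠ y in nhds t, (y ∈ roundShift w k ↔ t ∈ roundShift w k) := by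
      filter_upwards [e1, e3] with y hy1 hy3
      simp only [roundShift, Set.mem_ofPred_eq]
      rw [hy1, hy3]
    rw [frontier_eq_closure_inter_closure, Set.mem_inter_iff, mem_closure_iff_frequently,
      mem_closure_iff_frequently] at ht
    obtain ⟨y, hy, hy'⟩ := (ht.1.and_eventually e4).exists
    obtain ⟨z, hz, hz'⟩ := (ht.2.and_eventually e4).exists
    exact hz (hz'.2 (hy'.1 hy))
  exact measure_mono_null hsub
    (((Set.countable_range _).union (Set.countable_range _)).measure_zero _)

theorem volume_roundShift_inter (w : ℝ) (k : ℤ) :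
    volume.real (roundShift w k ∩ Set.Ico 0 1) = max 0 (1 - |w - k|) := by
  have hper : Function.Periodic ((roundShift w k).indicator fun _ => (1 : ℝ)) 1 := by
    intro t
    have := add_intCast_mem_roundShift w k t 1
    rw [Int.cast_one] at this
    by_cases h : t ∈ roundShift w k
    · rw [Set.indicator_of_mem h, Set.indicator_of_mem (this.2 h)]
    · rw [Set.indicator_of_notMem h, Set.indicator_of_notMem (fun h' => h (this.1 h'))]
  have hint : ∀ a b : ℝ, a ≤ b → ∫ t in a..b, (roundShift w k).indicator (fun _ => (1 : ℝ)) t =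
      volume.real (roundShift w k ∩ Set.Ioc a b) := by
    intro a b hab
    rw [intervalIntegral.integral_of_le hab, integral_indicator (measurableSet_roundShift w k),
      Measure.restrict_restrict (measurableSet_roundShift w k)]
    simp
  have heq := hper.intervalIntegral_add_eq 0 (-(1 / 2))
  rw [hint _ _ (by norm_num), hint _ _ (by norm_num)] at heq
  have hae : volume.real (roundShift w k ∩ Set.Ico 0 1) =
      volume.real (roundShift w k ∩ Set.Ioc 0 (0 + 1)) := by
    rw [zero_add]
    exact measureReal_congr ((ae_eq_refl _).inter Ico_ae_eq_Ioc)
  have hset : roundShift w k ∩ Set.Ioc (-(1 / 2)) (-(1 / 2) + 1) =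
      Set.Ioc (max (-(1 / 2)) (-(1 / 2) - (w - k))) (min (1 / 2) (1 / 2 - (w - k))) := by
    ext t
    simp only [Set.mem_inter_iff, Set.mem_Ioc, roundShift, Set.mem_ofPred_eq, max_lt_iff, le_min_iff]
    constructor
    · rintro ⟨h, h1, h2⟩
      have h0 : roundHalf t = 0 := roundHalf_eq_iff.2 ⟨by push_cast; linarith, by push_cast; linarith⟩
      rw [h0, zero_add, roundHalf_eq_iff] at h
      refine ⟨⟨h1, ?_⟩, ?_, ?_⟩ <;> linarith [h.1, h.2]
    · rintro ⟨⟨h1, h2⟩, h3, h4⟩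
      have h0 : roundHalf t = 0 := roundHalf_eq_iff.2 ⟨by push_cast; linarith, by push_cast; linarith⟩
      rw [h0, zero_add, roundHalf_eq_iff]
      refine ⟨⟨?_, ?_⟩, ?_, ?_⟩ <;> linarith
  rw [hae, heq, hset, measureReal_def, Real.volume_Ioc, ENNReal.toReal_ofReal', max_comm]
  congr 1
  rcases le_total 0 (w - k) with h | h
  · rw [abs_of_nonneg h, min_eq_right (by linarith), max_eq_left (by linarith)]; ring
  · rw [abs_of_nonpos h, min_eq_left (by linarith), max_eq_right (by linarith)]; ring

theorem phiFn_eq_prod {n : ℕ} (w : Fin n → ℝ) (u : Fin n → ℤ) :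
    phiFn w u = ∏ i, max 0 (1 - |w i - u i|) := by
  unfold phiFn
  split_ifs with h
  · refine Finset.prod_congr rfl fun i _ => (max_eq_right ?_).symm
    have := norm_le_pi_norm (w - intVec u) i
    simp only [Pi.sub_apply, intVec, Real.norm_eq_abs] at this
    linarith
  · rw [pi_norm_lt_iff one_pos] at h
    push Not at h
    obtain ⟨i, hi⟩ := h
    rw [Finset.prod_eq_zero (Finset.mem_univ i)]
    refine max_eq_left ?_
    simp only [Pi.sub_apply, intVec, Real.norm_eq_abs] at hi
    linarith

/-- The vectors whose discretization moves by exactly `u` under translation by `w`. -/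
def discShift {n : ℕ} (w : Fin n → ℝ) (u : Fin n → ℤ) : Set (Fin n → ℝ) :=
  Set.pi Set.univ fun i => roundShift (w i) (u i)

theorem mem_discShift {n : ℕ} {w : Fin n → ℝ} {u : Fin n → ℤ} {z : Fin n → ℝ} :
    z ∈ discShift w u ↔ discretizeR (z + w) = discretizeR z + intVec u := by
  simp only [discShift, Set.mem_univ_pi, roundShift, Set.mem_ofPred_eq, funext_iff, discretizeR,
    intVec, discretize, Pi.add_apply]
  exact forall_congr' fun i => by norm_cast

theorem add_intVec_mem_discShift {n : ℕ} (w : Fin n → ℝ) (u : Fin n → ℤ) (z : Fin n → ℝ)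
    (v : Fin n → ℤ) : z + intVec v ∈ discShift w u ↔ z ∈ discShift w u := by
  simp only [discShift, Set.mem_univ_pi, Pi.add_apply, intVec, add_intCast_mem_roundShift]

theorem volume_pi_inter_unitCube {n : ℕ} (T : Fin n → Set ℝ) :
    volume.real (Set.pi Set.univ T ∩ unitCube n) =
      ∏ i, volume.real (T i ∩ Set.Ico 0 1) := by
  rw [unitCube, ← Set.pi_inter_distrib, measureReal_def, volume_pi_pi, ENNReal.toReal_prod]
  rfl

theorem volume_closure_discShift {n : ℕ} (w : Fin n → ℝ) (u : Fin n → ℤ) :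
    volume.real (closure (discShift w u) ∩ unitCube n) = phiFn w u := by
  rw [discShift, closure_pi_set, volume_pi_inter_unitCube, phiFn_eq_prod]
  refine Finset.prod_congr rfl fun i _ => ?_
  rw [← volume_roundShift_inter]
  exact measureReal_congr ((closure_ae_eq_of_null_frontier
    (volume_frontier_roundShift _ _)).inter (ae_eq_refl _))

theorem volume_interior_discShift {n : ℕ} (w : Fin n → ℝ) (u : Fin n → ℤ) :
    volume.real (interior (discShift w u) ∩ unitCube n) = phiFn w u := by
  rw [discShift, interior_pi_set Set.finite_univ, volume_pi_inter_unitCube, phiFn_eq_prod]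
  refine Finset.prod_congr rfl fun i _ => ?_
  rw [← volume_roundShift_inter]
  exact measureReal_congr ((interior_ae_eq_of_null_frontier
    (volume_frontier_roundShift _ _)).inter (ae_eq_refl _))

theorem intVec_injective {n : ℕ} : Function.Injective (intVec (n := n)) := fun v w h =>
  funext fun i => by simpa [intVec] using congrFun h i

/-- The preimage under `P` of the ball of radius `R` about the origin. -/
def rotBall {n : ℕ} (P : Matrix (Fin n) (Fin n) ℝ) (R : ℝ) : Set (Fin n → ℝ) :=
  {x | ‖P.mulVec x‖ < R}

theorem rotBall_one {n : ℕ} (R : ℝ) :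
    rotBall (1 : Matrix (Fin n) (Fin n) ℝ) R = Metric.ball 0 R := by
  ext x; simp [rotBall]

theorem exists_norm_mulVec_le {n : ℕ} (P : Matrix (Fin n) (Fin n) ℝ) :
    ∃ C > 0, ∀ x, ‖P.mulVec x‖ ≤ C * ‖x‖ := by
  obtain ⟨C, hC, h⟩ := P.mulVecLin.toContinuousLinearMap.bound
  exact ⟨C, hC, h⟩

section Orthogonal

variable {n : ℕ} {P : Matrix (Fin n) (Fin n) ℝ}

theorem transpose_mulVec_mulVec (hP : P ∈ Matrix.orthogonalGroup (Fin n) ℝ) (x : Fin n → ℝ) :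
    P.transpose.mulVec (P.mulVec x) = x := by
  have h : P.transpose * P = 1 := (Matrix.mem_orthogonalGroup_iff' (Fin n) ℝ).1 hP
  rw [Matrix.mulVec_mulVec, h, Matrix.one_mulVec]

theorem mulVec_injective_of_orthogonal (hP : P ∈ Matrix.orthogonalGroup (Fin n) ℝ) :
    Function.Injective P.mulVec :=
  Function.LeftInverse.injective (transpose_mulVec_mulVec hP)

theorem exists_norm_le_mulVec (hP : P ∈ Matrix.orthogonalGroup (Fin n) ℝ) :
    ∃ C > 0, ∀ x, ‖x‖ ≤ C * ‖P.mulVec x‖ := by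
  obtain ⟨C, hC, h⟩ := exists_norm_mulVec_le P.transpose
  refine ⟨C, hC, fun x => ?_⟩
  conv_lhs => rw [← transpose_mulVec_mulVec hP x]
  exact h _

theorem isBounded_rotBall (hP : P ∈ Matrix.orthogonalGroup (Fin n) ℝ) (R : ℝ) :
    Bornology.IsBounded (rotBall P R) := by
  obtain ⟨C, hC, h⟩ := exists_norm_le_mulVec hP
  refine isBounded_iff_forall_norm_le.2 ⟨C * R, fun x hx => (h x).trans ?_⟩
  have : ‖P.mulVec x‖ < R := hx
  gcongr

theorem intPoints_eq_span : intPoints n =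
    (Submodule.span ℤ (Set.range (Pi.basisFun ℝ (Fin n))) : Set (Fin n → ℝ)) := by
  ext x
  rw [SetLike.mem_coe, Module.Basis.mem_span_iff_repr_mem]
  simp only [Pi.basisFun_repr, intPoints, Set.mem_range]
  constructor
  · rintro ⟨v, rfl⟩ i
    exact ⟨v i, rfl⟩
  · intro h
    choose v hv using h
    exact ⟨v, funext fun i => hv i⟩

theorem finite_inter_intPoints {s : Set (Fin n → ℝ)} (hs : Bornology.IsBounded s) :
    (s ∩ intPoints n).Finite := by
  rw [intPoints_eq_span]
  exact ZSpan.setFinite_inter _ hs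

theorem finite_inter_of_subset {s A : Set (Fin n → ℝ)} (hs : Bornology.IsBounded s)
    (hA : A ⊆ intPoints n) : (A ∩ s).Finite :=
  (finite_inter_intPoints hs).subset fun _ hx => ⟨hx.2, hA hx.1⟩

theorem convex_rotBall (R : ℝ) : Convex ℝ (rotBall P R) := by
  have : rotBall P R = P.mulVecLin ⁻¹' Metric.ball 0 R := by ext x; simp [rotBall]
  rw [this]
  exact (convex_ball _ _).linear_preimage _

theorem volume_rotBall_one (hP : P ∈ Matrix.orthogonalGroup (Fin n) ℝ) :
    volume.real (rotBall P 1) = 2 ^ n := by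
  have h : rotBall P 1 = P.toLin' ⁻¹' Metric.ball 0 1 := by ext x; simp [rotBall]
  have hdet : |P.det| = 1 := by
    have := Matrix.det_of_mem_unitary hP
    rcases (by simpa [Unitary.mem_iff, ← sq] using this : P.det = 1 ∨ P.det = -1) with h | h <;>
      simp [h]
  have hdet0 : LinearMap.det P.toLin' ≠ 0 := by
    rw [LinearMap.det_toLin']
    intro h; simp [h] at hdet
  rw [h, measureReal_def, Measure.addHaar_preimage_linearMap _ hdet0, LinearMap.det_toLin',
    abs_inv, hdet, Real.volume_pi_ball _ one_pos]
  simp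

open scoped Pointwise in
theorem smul_rotBall {r : ℝ} (hr : 0 < r) : r • rotBall P 1 = rotBall P r := by
  ext x
  rw [Set.mem_smul_set_iff_inv_smul_mem₀ hr.ne']
  simp only [rotBall, Set.mem_ofPred_eq, Matrix.mulVec_smul, norm_smul, norm_inv, Real.norm_eq_abs,
    abs_of_pos hr]
  rw [inv_mul_lt_iff₀ hr, mul_one]

open scoped Pointwise in
theorem tendsto_ncard_intPoints (hP : P ∈ Matrix.orthogonalGroup (Fin n) ℝ) :
    Tendsto (fun R : ℝ => ((intPoints n ∩ rotBall P R).ncard : ℝ) / (2 * R) ^ n) atTop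
      (nhds 1) := by
  have hopen : IsOpen (rotBall P 1) :=
    isOpen_lt (by fun_prop) continuous_const
  have h := tendsto_card_div_pow_atTop_volume' (rotBall P 1) (isBounded_rotBall hP 1)
    hopen.measurableSet ((convex_rotBall 1).addHaar_frontier _) (by
      intro x y hx hxy
      rw [smul_rotBall hx, smul_rotBall (hx.trans_le hxy)]
      exact fun z hz => lt_of_lt_of_le hz hxy)
  rw [volume_rotBall_one hP, Fintype.card_fin] at h
  have h2 := h.div_const (2 ^ n)
  rw [div_self (by positivity)] at h2
  refine h2.congr' ?_
  filter_upwards [eventually_gt_atTop 0] with R hR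
  have hset : (intPoints n ∩ rotBall P R).ncard =
      (rotBall P 1 ∩ R⁻¹ • intPoints n).ncard := by
    rw [← smul_rotBall hR, ← Set.ncard_image_of_injective _
      (smul_right_injective (Fin n → ℝ) (inv_ne_zero hR.ne')), Set.image_smul,
      Set.smul_set_inter₀ (inv_ne_zero hR.ne'), inv_smul_smul₀ hR.ne', Set.inter_comm]
  rw [mul_pow, div_div, mul_comm (R ^ n), hset, intPoints_eq_span]
  rfl

end Orthogonal

section Density

variable {n : ℕ} {P : Matrix (Fin n) (Fin n) ℝ}

theorem tendsto_div_cube_add {c : ℝ → ℝ} {d : ℝ}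
    (h : Tendsto (fun R => c R / (2 * R) ^ n) atTop (nhds d)) (a : ℝ) :
    Tendsto (fun R => c (R + a) / (2 * R) ^ n) atTop (nhds d) := by
  have h1 : Tendsto (fun R : ℝ => (1 + a / R) ^ n) atTop (nhds ((1 + 0) ^ n)) :=
    ((tendsto_const_nhds.div_atTop tendsto_id).const_add 1).pow n
  have h2 := (h.comp (tendsto_atTop_add_const_right atTop a tendsto_id)).mul h1
  rw [add_zero, one_pow, mul_one] at h2
  refine h2.congr' ?_
  filter_upwards [eventually_gt_atTop 0, eventually_gt_atTop (-a)] with R h3 h4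
  have h5 : R + a ≠ 0 := by linarith
  simp only [Function.comp, id]
  rw [show 1 + a / R = (2 * (R + a)) / (2 * R) by field_simp, div_pow]
  field_simp

theorem mul_ncard_rotBall_le (hP : P ∈ Matrix.orthogonalGroup (Fin n) ℝ) {C : ℝ}
    (hC : 0 < C) (hPC : ∀ x, ‖P.mulVec x‖ ≤ C * ‖x‖) {A B : Set (Fin n → ℝ)}
    (hA : A ⊆ intPoints n) (hB : B ⊆ intPoints n) {L α β : ℝ}
    (hα : ∀ x ∈ A, α ≤ ((Metric.ball x L ∩ B).ncard : ℝ))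
    (hβ : ∀ y ∈ B, ((Metric.ball y L ∩ A).ncard : ℝ) ≤ β) (R : ℝ) :
    α * ((A ∩ rotBall P R).ncard : ℝ) ≤ β * ((B ∩ rotBall P (R + C * L)).ncard : ℝ) := by
  classical
  have hAf := finite_inter_of_subset (isBounded_rotBall hP R) hA
  have hBf := finite_inter_of_subset (isBounded_rotBall hP (R + C * L)) hB
  have hsum := Finset.sum_card_bipartiteAbove_eq_sum_card_bipartiteBelow
    (s := hAf.toFinset) (t := hBf.toFinset) (fun x y => dist x y < L)
  have h1 : α * ((A ∩ rotBall P R).ncard : ℝ) ≤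
      ∑ x ∈ hAf.toFinset, ((hBf.toFinset.bipartiteAbove (fun x y => dist x y < L) x).card : ℝ) := by
    rw [Set.ncard_eq_toFinset_card _ hAf, mul_comm, ← nsmul_eq_mul]
    refine Finset.card_nsmul_le_sum _ _ _ fun x hx => ?_
    rw [Set.Finite.mem_toFinset] at hx
    refine (hα x hx.1).trans ?_
    rw [← Set.ncard_coe_finset]
    refine Nat.cast_le.2 (Set.ncard_le_ncard ?_ (Finset.finite_toSet _))
    rintro y ⟨hy, hyB⟩
    rw [Metric.mem_ball, dist_comm] at hy
    simp only [Finset.bipartiteAbove, Finset.coe_filter, Set.Finite.mem_toFinset,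
      Set.mem_ofPred_eq]
    refine ⟨⟨hyB, ?_⟩, hy⟩
    have h2 : ‖P.mulVec x‖ < R := hx.2
    have h3 : P.mulVec y = P.mulVec x + P.mulVec (y - x) := by
      rw [← Matrix.mulVec_add, add_sub_cancel]
    change ‖P.mulVec y‖ < R + C * L
    rw [h3]
    rw [dist_comm, dist_eq_norm] at hy
    calc _ ≤ ‖P.mulVec x‖ + ‖P.mulVec (y - x)‖ := norm_add_le _ _
      _ < R + C * L := by
        have := hPC (y - x)
        have : C * ‖y - x‖ < C * L := by gcongr
        linarith
  have h2 : ∑ y ∈ hBf.toFinset,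
      ((hAf.toFinset.bipartiteBelow (fun x y => dist x y < L) y).card : ℝ) ≤
      β * ((B ∩ rotBall P (R + C * L)).ncard : ℝ) := by
    rw [Set.ncard_eq_toFinset_card _ hBf, mul_comm β, ← nsmul_eq_mul]
    refine Finset.sum_le_card_nsmul _ _ _ fun y hy => ?_
    rw [Set.Finite.mem_toFinset] at hy
    refine le_trans ?_ (hβ y hy.1)
    rw [← Set.ncard_coe_finset]
    refine Nat.cast_le.2 (Set.ncard_le_ncard ?_ ?_)
    · intro x hx
      simp only [Finset.bipartiteBelow, Finset.coe_filter, Set.Finite.mem_toFinset,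
        Set.mem_ofPred_eq] at hx
      exact ⟨hx.2, hx.1.1⟩
    · rw [Set.inter_comm]
      exact finite_inter_of_subset Metric.isBounded_ball hA
  refine h1.trans (le_trans (le_of_eq ?_) h2)
  exact_mod_cast hsum

theorem add_mem_intPoints {x y : Fin n → ℝ} (hx : x ∈ intPoints n) (hy : y ∈ intPoints n) :
    x + y ∈ intPoints n := by
  obtain ⟨v, rfl⟩ := hx
  obtain ⟨w, rfl⟩ := hy
  exact ⟨v + w, by ext i; simp [intVec]⟩

theorem neg_mem_intPoints {x : Fin n → ℝ} (hx : x ∈ intPoints n) : -x ∈ intPoints n := by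
  obtain ⟨v, rfl⟩ := hx
  exact ⟨-v, by ext i; simp [intVec]⟩

theorem ncard_ball_inter_intPoints {y : Fin n → ℝ} (hy : y ∈ intPoints n) (L : ℝ) :
    (Metric.ball y L ∩ intPoints n).ncard = (Metric.ball 0 L ∩ intPoints n).ncard := by
  rw [← Set.ncard_image_of_injective (Metric.ball 0 L ∩ intPoints n) (add_left_injective y)]
  congr 1
  ext x
  simp only [Set.mem_inter_iff, Set.mem_image]
  constructor
  · rintro ⟨h1, h2⟩
    exact ⟨x - y, ⟨by simpa [dist_eq_norm] using h1,
      by simpa [sub_eq_add_neg] using add_mem_intPoints h2 (neg_mem_intPoints hy)⟩, by simp⟩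
  · rintro ⟨z, ⟨h1, h2⟩, rfl⟩
    exact ⟨by simpa [dist_eq_norm] using h1, add_mem_intPoints h2 hy⟩

theorem ncard_ball_inter_intPoints_pos {L : ℝ} (hL : 0 < L) :
    0 < (Metric.ball 0 L ∩ intPoints n).ncard := by
  rw [Set.ncard_pos (finite_inter_intPoints Metric.isBounded_ball)]
  exact ⟨0, Metric.mem_ball_self hL, 0, by ext; simp [intVec]⟩

/-- A uniform density over cubes is also a density over rotated cubes. -/
theorem HasUnifDensity.tendsto_rotBall (hP : P ∈ Matrix.orthogonalGroup (Fin n) ℝ)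
    {A : Set (Fin n → ℝ)} (hA : A ⊆ intPoints n) {d : ℝ} (hd : HasUnifDensity A d) :
    Tendsto (fun R : ℝ => ((A ∩ rotBall P R).ncard : ℝ) / (2 * R) ^ n) atTop (nhds d) := by
  obtain ⟨C, hC, hPC⟩ := exists_norm_mulVec_le P
  rw [Metric.tendsto_nhds]
  intro ε hε
  obtain ⟨L, hL, hLd⟩ := hd (ε / 2) (by positivity)
  have hm : (0 : ℝ) < (Metric.ball (0 : Fin n → ℝ) L ∩ intPoints n).ncard := by
    exact_mod_cast ncard_ball_inter_intPoints_pos hL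
  set m : ℝ := ((Metric.ball (0 : Fin n → ℝ) L ∩ intPoints n).ncard : ℝ) with hmdef
  have hcnt : ∀ y ∈ intPoints n, (d - ε / 2) * m ≤ ((Metric.ball y L ∩ A).ncard : ℝ) ∧
      ((Metric.ball y L ∩ A).ncard : ℝ) ≤ (d + ε / 2) * m := by
    intro y hy
    have := hLd L le_rfl y
    rw [ncard_ball_inter_intPoints hy, abs_le] at this
    rw [← le_div_iff₀ hm, ← div_le_iff₀ hm]
    constructor <;> linarith [this.1, this.2]
  have hZ : ∀ y ∈ A, ((Metric.ball y L ∩ intPoints n).ncard : ℝ) = m := fun y hy => by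
    rw [ncard_ball_inter_intPoints (hA hy)]
  have hup : ∀ R, ((A ∩ rotBall P R).ncard : ℝ) ≤
      (d + ε / 2) * ((intPoints n ∩ rotBall P (R + C * L)).ncard : ℝ) := by
    intro R
    have := mul_ncard_rotBall_le hP hC hPC hA subset_rfl (fun x hx => (hZ x hx).ge)
      (fun y hy => (hcnt y hy).2) R
    refine le_of_mul_le_mul_left (this.trans (le_of_eq ?_)) hm
    ring
  have hlow : ∀ R, (d - ε / 2) * ((intPoints n ∩ rotBall P (R + -(C * L))).ncard : ℝ) ≤
      ((A ∩ rotBall P R).ncard : ℝ) := by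
    intro R
    have := mul_ncard_rotBall_le hP hC hPC subset_rfl hA (fun x hx => (hcnt x hx).1)
      (fun y hy => (hZ y hy).le) (R + -(C * L))
    rw [neg_add_cancel_right] at this
    refine le_of_mul_le_mul_left ((le_of_eq ?_).trans this) hm
    ring
  have hlim := tendsto_ncard_intPoints hP
  have h1 := (tendsto_div_cube_add hlim (C * L)).const_mul (d + ε / 2)
  have h2 := (tendsto_div_cube_add hlim (-(C * L))).const_mul (d - ε / 2)
  filter_upwards [h1.eventually_lt_const (show (d + ε / 2) * 1 < d + ε by linarith),
    h2.eventually_const_lt (show d - ε < (d - ε / 2) * 1 by linarith),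
    eventually_gt_atTop 0] with R h3 h4 hR
  have hpos : (0 : ℝ) < (2 * R) ^ n := by positivity
  rw [Real.dist_eq, abs_lt]
  rw [← mul_div_assoc] at h3 h4
  have h5 := div_le_div_of_nonneg_right (hup R) hpos.le
  have h6 := div_le_div_of_nonneg_right (hlow R) hpos.le
  constructor <;> linarith

theorem HasUnifDensity.tendsto_ball {A : Set (Fin n → ℝ)} (hA : A ⊆ intPoints n) {d : ℝ}
    (hd : HasUnifDensity A d) :
    Tendsto (fun R : ℝ => ((A ∩ Metric.ball 0 R).ncard : ℝ) / (2 * R) ^ n) atTop (nhds d) := by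
  simpa only [rotBall_one] using hd.tendsto_rotBall (one_mem _) hA

end Density

section Differences

variable {n : ℕ} {P : Matrix (Fin n) (Fin n) ℝ} {Γ : Set (Fin n → ℝ)}

theorem norm_discretizeR_sub_le (x : Fin n → ℝ) : ‖discretizeR x - x‖ ≤ 1 := by
  rw [pi_norm_le_iff_of_nonneg zero_le_one]
  intro i
  obtain ⟨h1, h2⟩ := roundHalf_eq_iff.1 (rfl : roundHalf (x i) = roundHalf (x i))
  simp only [Pi.sub_apply, discretizeR, intVec, discretize, Real.norm_eq_abs, abs_le]
  constructor <;> linarith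

theorem norm_lt_of_discretizeR_lt {x : Fin n → ℝ} {R : ℝ} (h : ‖discretizeR x‖ < R) :
    ‖x‖ < R + 1 := by
  have h1 := norm_discretizeR_sub_le x
  have h2 := norm_sub_le (discretizeR x) (discretizeR x - x)
  rw [sub_sub_cancel] at h2
  linarith

theorem norm_discretizeR_lt {x : Fin n → ℝ} {R : ℝ} (h : ‖x‖ < R) :
    ‖discretizeR x‖ < R + 1 := by
  have h1 := norm_discretizeR_sub_le x
  have h2 := norm_add_le (discretizeR x - x) x
  rw [sub_add_cancel] at h2
  linarith

theorem norm_sub_lt_one_of_mem_discShift {w z : Fin n → ℝ} {u : Fin n → ℤ}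
    (h : z ∈ discShift w u) : ‖w - intVec u‖ < 1 := by
  rw [pi_norm_lt_iff one_pos]
  intro i
  have hi : roundHalf (z i + w i) = roundHalf (z i) + u i := h i (Set.mem_univ i)
  obtain ⟨h1, h2⟩ := roundHalf_eq_iff.1 (rfl : roundHalf (z i) = roundHalf (z i))
  obtain ⟨h3, h4⟩ := roundHalf_eq_iff.1 hi
  push_cast at h3 h4
  simp only [Pi.sub_apply, intVec, Real.norm_eq_abs, abs_lt]
  constructor <;> linarith

theorem PhatImg_subset_intPoints : PhatImg P Γ ⊆ intPoints n := by
  rintro _ ⟨x, -, rfl⟩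
  exact ⟨_, rfl⟩

theorem finite_mulVec_near (hP : P ∈ Matrix.orthogonalGroup (Fin n) ℝ) (u : Fin n → ℤ) :
    {v : Fin n → ℤ | ‖P.mulVec (intVec v) - intVec u‖ < 1}.Finite := by
  have h := finite_inter_intPoints (isBounded_rotBall hP (1 + ‖intVec u‖))
  refine (h.preimage intVec_injective.injOn).subset fun v hv => ⟨?_, v, rfl⟩
  have h1 := norm_add_le (P.mulVec (intVec v) - intVec u) (intVec u)
  rw [sub_add_cancel] at h1
  have h2 : ‖P.mulVec (intVec v) - intVec u‖ < 1 := hv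
  change ‖P.mulVec (intVec v)‖ < _
  linarith

/-- The points `x` of `Γ` with `x + v` in `Γ` whose discretized images differ by `u`. -/
def shiftedPairs (P : Matrix (Fin n) (Fin n) ℝ) (Γ : Set (Fin n → ℝ)) (v u : Fin n → ℤ) :
    Set (Fin n → ℝ) :=
  {x | x ∈ diffSet Γ (intVec v) ∧ P.mulVec x ∈ discShift (P.mulVec (intVec v)) u}

theorem discretizeR_add_of_mem_shiftedPairs {v u : Fin n → ℤ} {x : Fin n → ℝ}
    (hx : x ∈ shiftedPairs P Γ v u) :
    discretizeR (P.mulVec (x + intVec v)) = discretizeR (P.mulVec x) + intVec u := by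
  rw [Matrix.mulVec_add]
  exact mem_discShift.1 hx.2

theorem tendsto_ncard_shiftedPairs (hΓ : Γ ⊆ intPoints n)
    (hP : P ∈ Matrix.orthogonalGroup (Fin n) ℝ) {v : Fin n → ℤ}
    (hequi : EquidistributedModZn (P.mulVec '' diffSet Γ (intVec v))) {d : ℝ}
    (hd : HasUnifDensity (diffSet Γ (intVec v)) d) (u : Fin n → ℤ) :
    Tendsto (fun R : ℝ => ((shiftedPairs P Γ v u ∩ rotBall P R).ncard : ℝ) / (2 * R) ^ n) atTop
      (nhds (phiFn (P.mulVec (intVec v)) u * d)) := by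
  have hsub : diffSet Γ (intVec v) ⊆ intPoints n := fun x hx => hΓ hx.1
  have hinj := mulVec_injective_of_orthogonal hP
  have himg : ∀ R, P.mulVec '' diffSet Γ (intVec v) ∩ Metric.ball 0 R =
      P.mulVec '' (diffSet Γ (intVec v) ∩ rotBall P R) := by
    intro R
    rw [show rotBall P R = P.mulVec ⁻¹' Metric.ball 0 R by ext; simp [rotBall],
      Set.image_inter_preimage]
  have himg' : ∀ R, P.mulVec '' diffSet Γ (intVec v) ∩ Metric.ball 0 R ∩
      discShift (P.mulVec (intVec v)) u = P.mulVec '' (shiftedPairs P Γ v u ∩ rotBall P R) := by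
    intro R
    rw [himg, ← Set.image_inter_preimage]
    congr 1
    ext x
    simp only [shiftedPairs, Set.mem_inter_iff, Set.mem_ofPred_eq, Set.mem_preimage]
    tauto
  have hfin : ∀ R, (P.mulVec '' diffSet Γ (intVec v) ∩ Metric.ball 0 R).Finite := fun R => by
    rw [himg]
    exact (finite_inter_of_subset (isBounded_rotBall hP R) hsub).image _
  have h := hequi.tendsto_ncard hfin (add_intVec_mem_discShift (P.mulVec (intVec v)) u)
    (volume_closure_discShift _ _) (volume_interior_discShift _ _)
    (g := fun R => (2 * R) ^ n) (d := d) ?_ ?_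
  · simpa only [himg', Set.ncard_image_of_injective _ hinj] using h
  · simpa only [himg, Set.ncard_image_of_injective _ hinj] using hd.tendsto_rotBall hP hsub
  · filter_upwards [eventually_gt_atTop 0] with R hR
    positivity

theorem ncard_diffSet_PhatImg_le (hΓ : Γ ⊆ intPoints n)
    (hP : P ∈ Matrix.orthogonalGroup (Fin n) ℝ) {u : Fin n → ℤ} {V : Finset (Fin n → ℤ)}
    (hV : ∀ v : Fin n → ℤ, ‖P.mulVec (intVec v) - intVec u‖ < 1 → v ∈ V) (R : ℝ) :
    (diffSet (PhatImg P Γ) (intVec u) ∩ Metric.ball 0 R).ncard ≤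
      ∑ v ∈ V, (shiftedPairs P Γ v u ∩ rotBall P (R + 1)).ncard := by
  have hfin : ∀ v, (shiftedPairs P Γ v u ∩ rotBall P (R + 1)).Finite := fun v =>
    finite_inter_of_subset (isBounded_rotBall hP _) fun x hx => hΓ hx.1.1
  have hsub : diffSet (PhatImg P Γ) (intVec u) ∩ Metric.ball 0 R ⊆
      ⋃ v ∈ V, (fun x => discretizeR (P.mulVec x)) ''
        (shiftedPairs P Γ v u ∩ rotBall P (R + 1)) := by
    rintro _ ⟨⟨⟨x, hx, rfl⟩, x', hx', hxx'⟩, hR⟩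
    rw [mem_ball_zero_iff] at hR
    obtain ⟨w, rfl⟩ := hΓ hx
    obtain ⟨w', rfl⟩ := hΓ hx'
    have hadd : intVec w + intVec (w' - w) = intVec w' := by ext i; simp [intVec]
    have hmem : P.mulVec (intVec w) ∈ discShift (P.mulVec (intVec (w' - w))) u := by
      rw [mem_discShift, ← Matrix.mulVec_add, hadd]
      exact hxx'
    refine Set.mem_biUnion (hV (w' - w) (norm_sub_lt_one_of_mem_discShift hmem))
      ⟨intVec w, ⟨⟨⟨hx, ?_⟩, hmem⟩, norm_lt_of_discretizeR_lt hR⟩, rfl⟩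
    change intVec w + intVec (w' - w) ∈ Γ
    rwa [hadd]
  refine (Set.ncard_le_ncard hsub ?_).trans ((Finset.set_ncard_biUnion_le _ _).trans
    (Finset.sum_le_sum fun v _ => Set.ncard_image_le (hfin v)))
  exact V.finite_toSet.biUnion fun v _ => (hfin v).image _

theorem sum_ncard_shiftedPairs_le {Γ' : Set (Fin n → ℝ)} (hΓ : Γ' ⊆ intPoints n)
    (hP : P ∈ Matrix.orthogonalGroup (Fin n) ℝ)
    (hinj : Set.InjOn (fun x => discretizeR (P.mulVec x)) Γ')
    (u : Fin n → ℤ) (V : Finset (Fin n → ℤ)) (R : ℝ) :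
    ∑ v ∈ V, (shiftedPairs P Γ' v u ∩ rotBall P R).ncard ≤
      (diffSet (PhatImg P Γ') (intVec u) ∩ Metric.ball 0 (R + 1)).ncard := by
  have hfin : ∀ v, (shiftedPairs P Γ' v u ∩ rotBall P R).Finite := fun v =>
    finite_inter_of_subset (isBounded_rotBall hP _) fun x hx => hΓ hx.1.1
  have hdisj : (V : Set (Fin n → ℤ)).PairwiseDisjoint
      fun v => shiftedPairs P Γ' v u ∩ rotBall P R := by
    intro v _ v' _ hne
    refine Set.disjoint_left.2 fun x hx hx' => hne ?_
    have h : x + intVec v = x + intVec v' := hinj hx.1.1.2 hx'.1.1.2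
      ((discretizeR_add_of_mem_shiftedPairs hx.1).trans
        (discretizeR_add_of_mem_shiftedPairs hx'.1).symm)
    exact intVec_injective (add_left_cancel h)
  have hunion := V.finite_toSet.ncard_biUnion (fun v _ => hfin v) hdisj
  rw [finsum_mem_coe_finset] at hunion
  rw [← hunion]
  refine Set.ncard_le_ncard_of_injOn (fun x => discretizeR (P.mulVec x)) ?_ ?_ ?_
  · intro x hx
    obtain ⟨v, -, hx, hxR⟩ := Set.mem_iUnion₂.1 hx
    refine ⟨⟨⟨x, hx.1.1, rfl⟩, x + intVec v, hx.1.2, discretizeR_add_of_mem_shiftedPairs hx⟩, ?_⟩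
    rw [mem_ball_zero_iff]
    exact norm_discretizeR_lt hxR
  · refine hinj.mono fun x hx => ?_
    obtain ⟨v, -, hx, -⟩ := Set.mem_iUnion₂.1 hx
    exact hx.1.1
  · exact finite_inter_of_subset Metric.isBounded_ball
      fun x hx => PhatImg_subset_intPoints hx.1

theorem ncard_shiftedPairs_le_add {Γ' : Set (Fin n → ℝ)} (hΓ : Γ ⊆ intPoints n)
    (hΓ' : Γ' ⊆ Γ) (hP : P ∈ Matrix.orthogonalGroup (Fin n) ℝ) (v u : Fin n → ℤ) (R : ℝ) :
    (shiftedPairs P Γ v u ∩ rotBall P R).ncard ≤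
      (shiftedPairs P Γ' v u ∩ rotBall P R).ncard + (((Γ \ Γ') ∩ rotBall P R).ncard +
        ((Γ \ Γ') ∩ rotBall P (R + ‖P.mulVec (intVec v)‖)).ncard) := by
  have hfin : ∀ S, ((Γ \ Γ') ∩ rotBall P S).Finite := fun S =>
    finite_inter_of_subset (isBounded_rotBall hP _) fun x hx => hΓ hx.1
  have hsub : shiftedPairs P Γ v u ∩ rotBall P R ⊆
      shiftedPairs P Γ' v u ∩ rotBall P R ∪ ((Γ \ Γ') ∩ rotBall P R ∪
        (fun y => y - intVec v) '' ((Γ \ Γ') ∩ rotBall P (R + ‖P.mulVec (intVec v)‖))) := by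
    rintro x ⟨⟨⟨hx, hxv⟩, hs⟩, hR⟩
    by_cases h1 : x ∈ Γ'
    · by_cases h2 : x + intVec v ∈ Γ'
      · exact Or.inl ⟨⟨⟨h1, h2⟩, hs⟩, hR⟩
      · refine Or.inr (Or.inr ⟨x + intVec v, ⟨⟨hxv, h2⟩, ?_⟩, by simp⟩)
        have h3 : ‖P.mulVec x‖ < R := hR
        have h4 := norm_add_le (P.mulVec x) (P.mulVec (intVec v))
        change ‖P.mulVec (x + intVec v)‖ < _
        rw [Matrix.mulVec_add]
        linarith
    · exact Or.inr (Or.inl ⟨⟨hx, h1⟩, hR⟩)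
  have hfin' : (shiftedPairs P Γ' v u ∩ rotBall P R).Finite :=
    finite_inter_of_subset (isBounded_rotBall hP _) fun x hx => hΓ (hΓ' hx.1.1)
  refine (Set.ncard_le_ncard hsub (hfin'.union ((hfin _).union ((hfin _).image _)))).trans ?_
  refine (Set.ncard_union_le _ _).trans (Nat.add_le_add_left ?_ _)
  exact (Set.ncard_union_le _ _).trans (Nat.add_le_add_left (Set.ncard_image_le (hfin _)) _)

theorem ncard_diff_add_ncard_PhatImg_le {Γ' : Set (Fin n → ℝ)} (hΓ : Γ ⊆ intPoints n)
    (hΓ' : Γ' ⊆ Γ) (hP : P ∈ Matrix.orthogonalGroup (Fin n) ℝ)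
    (himg : PhatImg P Γ' = PhatImg P Γ) (R : ℝ) :
    ((Γ \ Γ') ∩ rotBall P R).ncard + (PhatImg P Γ ∩ Metric.ball 0 R).ncard ≤
      (Γ ∩ rotBall P (R + 1)).ncard := by
  have hfin := finite_inter_of_subset (isBounded_rotBall hP (R + 1)) hΓ
  have hfin' := hfin.subset (Set.inter_subset_inter_left (rotBall P (R + 1)) hΓ')
  have hsub : PhatImg P Γ ∩ Metric.ball 0 R ⊆
      (fun x => discretizeR (P.mulVec x)) '' (Γ' ∩ rotBall P (R + 1)) := by
    rw [← himg]
    rintro _ ⟨⟨x, hx, rfl⟩, hR⟩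
    rw [mem_ball_zero_iff] at hR
    exact ⟨x, ⟨hx, norm_lt_of_discretizeR_lt hR⟩, rfl⟩
  have h1 := (Set.ncard_le_ncard hsub (hfin'.image _)).trans (Set.ncard_image_le hfin')
  have hdiff : (Γ \ Γ') ∩ rotBall P R ⊆ (Γ ∩ rotBall P (R + 1)) \ (Γ' ∩ rotBall P (R + 1)) := by
    rintro x ⟨⟨hx, hx'⟩, hR⟩
    refine ⟨⟨hx, ?_⟩, fun h => hx' h.1⟩
    have hR' : ‖P.mulVec x‖ < R := hR
    change ‖P.mulVec x‖ < R + 1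
    linarith
  have h2 := Set.ncard_le_ncard hdiff hfin.sdiff
  have h3 := Set.ncard_sdiff_add_ncard_of_subset
    (Set.inter_subset_inter_left (rotBall P (R + 1)) hΓ') hfin
  omega

end Differences

/-- Action of a discretization on frequencies of differences, equal-density case:
if `D(P̂(Γ)) = D(Γ)`, then `ρ_{P̂(Γ)}(u) = Σ_v φ_{Pv}(u) ρ_Γ(v)`. -/
theorem statement10 {n : ℕ} (Γ : Set (Fin n → ℝ)) (hΓ : AlmostPeriodicPattern Γ)
    (P : Matrix (Fin n) (Fin n) ℝ) (hP : P ∈ Matrix.orthogonalGroup (Fin n) ℝ)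
    (hequi : ∀ v : Fin n → ℤ, EquidistributedModZn (P.mulVec '' diffSet Γ (intVec v)))
    (D : ℝ) (hD : HasUnifDensity Γ D) (hDpos : 0 < D)
    (hDeq : HasUnifDensity (PhatImg P Γ) D)
    (ρ ρ' : (Fin n → ℤ) → ℝ)
    (hρ : ∀ v : Fin n → ℤ, HasUnifDensity (diffSet Γ (intVec v)) (ρ v * D))
    (hρ' : ∀ v : Fin n → ℤ, HasUnifDensity (diffSet (PhatImg P Γ) (intVec v)) (ρ' v * D)) :
    ∀ u : Fin n → ℤ,
      ρ' u = ∑ᶠ v : Fin n → ℤ, phiFn (P.mulVec (intVec v)) u * ρ v := by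
  classical
  intro u
  have hΓZ : Γ ⊆ intPoints n := hΓ.1
  obtain ⟨Γ', hΓ', hbij⟩ :=
    Set.exists_subset_bijOn Γ (fun x : Fin n → ℝ => discretizeR (P.mulVec x))
  have himg : PhatImg P Γ' = PhatImg P Γ := hbij.image_eq
  have hexc : Tendsto (fun R : ℝ => (((Γ \ Γ') ∩ rotBall P R).ncard : ℝ) / (2 * R) ^ n) atTop
      (nhds 0) := by
    have h1 := (tendsto_div_cube_add (hD.tendsto_rotBall hP hΓZ) 1).sub
      (hDeq.tendsto_ball PhatImg_subset_intPoints)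
    rw [sub_self] at h1
    refine tendsto_of_tendsto_of_tendsto_of_le_of_le' tendsto_const_nhds h1 ?_ ?_
    · filter_upwards [eventually_gt_atTop 0] with R hR
      positivity
    · filter_upwards [eventually_gt_atTop 0] with R hR
      rw [← sub_div]
      gcongr
      rw [le_sub_iff_add_le]
      exact_mod_cast ncard_diff_add_ncard_PhatImg_le hΓZ hΓ' hP himg R
  set V : Finset (Fin n → ℤ) := (finite_mulVec_near hP u).toFinset
  have hV : ∀ v : Fin n → ℤ, ‖P.mulVec (intVec v) - intVec u‖ < 1 → v ∈ V := fun v hv => by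
    simpa [V] using hv
  have hpairs : Tendsto (fun R : ℝ => (∑ v ∈ V, ((shiftedPairs P Γ v u ∩ rotBall P R).ncard : ℝ)) /
      (2 * R) ^ n) atTop (nhds (∑ v ∈ V, phiFn (P.mulVec (intVec v)) u * (ρ v * D))) := by
    simp only [Finset.sum_div]
    exact tendsto_finsetSum _ fun v _ => tendsto_ncard_shiftedPairs hΓZ hP (hequi v) (hρ v) u
  have himage := (hρ' u).tendsto_ball
    fun x (hx : x ∈ diffSet (PhatImg P Γ) (intVec u)) => PhatImg_subset_intPoints hx.1
  have hle : ρ' u * D ≤ ∑ v ∈ V, phiFn (P.mulVec (intVec v)) u * (ρ v * D) := by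
    refine le_of_tendsto_of_tendsto himage (tendsto_div_cube_add hpairs 1) ?_
    filter_upwards [eventually_gt_atTop 0] with R hR
    gcongr
    exact_mod_cast ncard_diffSet_PhatImg_le hΓZ hP hV R
  have hge : ∑ v ∈ V, phiFn (P.mulVec (intVec v)) u * (ρ v * D) ≤ ρ' u * D := by
    have herr : Tendsto (fun R : ℝ => ∑ v ∈ V, ((((Γ \ Γ') ∩ rotBall P R).ncard : ℝ) / (2 * R) ^ n +
        (((Γ \ Γ') ∩ rotBall P (R + ‖P.mulVec (intVec v)‖)).ncard : ℝ) / (2 * R) ^ n)) atTop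
        (nhds (∑ v ∈ V, (0 + 0))) :=
      tendsto_finsetSum _ fun v _ => hexc.add (tendsto_div_cube_add hexc _)
    have hub := (tendsto_div_cube_add himage 1).add herr
    simp only [add_zero, Finset.sum_const_zero] at hub
    refine le_of_tendsto_of_tendsto hpairs hub ?_
    filter_upwards [eventually_gt_atTop 0] with R hR
    simp only [← add_div, ← Finset.sum_div]
    gcongr
    have h1 := Finset.sum_le_sum fun v (_ : v ∈ V) =>
      ncard_shiftedPairs_le_add hΓZ hΓ' hP v u R
    have h2 := sum_ncard_shiftedPairs_le (hΓ'.trans hΓZ) hP hbij.injOn u V R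
    rw [himg] at h2
    rw [Finset.sum_add_distrib] at h1
    exact_mod_cast h1.trans (Nat.add_le_add_right h2 _)
  have hsupp : (Function.support fun v : Fin n → ℤ => phiFn (P.mulVec (intVec v)) u * ρ v) ⊆
      V := by
    intro v hv
    refine hV v (by_contra fun h => hv ?_)
    simp [phiFn, h]
  rw [finsum_eq_sum_of_support_subset _ hsupp]
  refine mul_right_cancel₀ hDpos.ne' ((le_antisymm hle hge).trans ?_)
  rw [Finset.sum_mul]
  exact Finset.sum_congr rfl fun v _ => (mul_assoc _ _ _).symm

end
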